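/- arXiv:2002.06004 — 8 statements merged into one kernel-verified Lean document; each statement's English description precedes it below -/
import Mathlib

section
/- (SC4 ⟹ SC1) Let → be a terminating relation on a set E. If the canonical map NF(→) → E/↔*, sending each normal form to its equivalence class modulo ↔*, is a bijection, then → is locally confluent. -/
/-- (SC4 ⟹ SC1) For a terminating relation, if the canonical map from the set of normal
forms to the quotient by the generated equivalence relation is a bijection, then the
relation is locally confluent. -/
theorem locally_confluent_of_nf_to_quotient_bijective {E : Type*} (r : E → E → Prop)
    (hterm : WellFounded (fun a b => r b a))
    (hbij : Function.Bijective
      (fun x : {x : E // ∀ y, ¬ r x y} => Quot.mk (Relation.EqvGen r) x.val)) :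
    ∀ u v w, r u v → r u w →
      ∃ z, Relation.ReflTransGen r v z ∧ Relation.ReflTransGen r w z := by
  have hnf : ∀ a, ∃ n, Relation.ReflTransGen r a n ∧ ∀ y, ¬ r n y := by
    intro a
    induction a using hterm.induction with
    | _ a ih =>
      by_cases h : ∃ b, r a b
      · obtain ⟨b, hb⟩ := h
        obtain ⟨n, hn, hn2⟩ := ih b hb
        exact ⟨n, Relation.ReflTransGen.head hb hn, hn2⟩
      · exact ⟨a, Relation.ReflTransGen.refl, fun y hy => h ⟨y, hy⟩⟩
  have hq : ∀ a b, Relation.ReflTransGen r a b →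
      Quot.mk (Relation.EqvGen r) a = Quot.mk (Relation.EqvGen r) b := by
    intro a b h
    induction h with
    | refl => rfl
    | tail _ h ih => exact ih.trans (Quot.sound (Relation.EqvGen.rel _ _ h))
  intro u v w huv huw
  obtain ⟨n, hvn, hn⟩ := hnf v
  obtain ⟨m, hwm, hm⟩ := hnf w
  have key : (⟨n, hn⟩ : {x : E // ∀ y, ¬ r x y}) = ⟨m, hm⟩ := by
    apply hbij.1
    exact (hq u n (Relation.ReflTransGen.head huv hvn)).symm.trans
      (hq u m (Relation.ReflTransGen.head huw hwm))
  have hnm : n = m := congrArg Subtype.val key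
  subst hnm
  exact ⟨n, hvn, hwm⟩
end

section
/- Let k be a field of characteristic 0, X a set, and r an algebraic relation on kX. If u →_alg v, then there exists w ∈ kX such that u (→_wf)^= w and v (→_wf)^= w, where (→_wf)^= denotes the reflexive closure of →_wf (that is, u = w or u →_wf w, and v = w or v →_wf w). -/
/-- The relation `→_alg` on `kX` induced by an algebraic relation `r`:
`u →_alg v` iff there are `λ ∈ k`, `x ∈ X`, `u', w ∈ kX` with `r x u'`,
`u = λ·x + w` and `v = λ·u' + w`. -/
def AlgStep {k : Type*} {X : Type*} [Field k] (r : X → (X →₀ k) → Prop)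
    (u v : X →₀ k) : Prop :=
  ∃ (lam : k) (x : X) (u' w : X →₀ k), r x u' ∧
    u = lam • Finsupp.single x 1 + w ∧ v = lam • u' + w

/-- The relation `→_wf` on `kX` induced by an algebraic relation `r`: the restriction
of `→_alg` to the case where `λ ≠ 0` and `x ∉ supp(w)`. -/
def WfStep {k : Type*} {X : Type*} [Field k] (r : X → (X →₀ k) → Prop)
    (u v : X →₀ k) : Prop :=
  ∃ (lam : k) (x : X) (u' w : X →₀ k), r x u' ∧ lam ≠ 0 ∧ x ∉ w.support ∧
    u = lam • Finsupp.single x 1 + w ∧ v = lam • u' + w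

/-- If `u →_alg v`, then `u` and `v` are joined by at most one `→_wf`-step each. -/
theorem algStep_join_wfStep {k : Type*} {X : Type*} [Field k] [CharZero k]
    (r : X → (X →₀ k) → Prop) (halg : ∀ x u, r x u → x ∉ u.support) :
    ∀ u v : X →₀ k, AlgStep r u v →
      ∃ w : X →₀ k, (u = w ∨ WfStep r u w) ∧ (v = w ∨ WfStep r v w) := by
  rintro u v ⟨lam, x, u', w, hr, rfl, rfl⟩
  have hx : u' x = 0 := by simpa using halg x u' hr
  obtain ⟨w0, m, hw0, rfl⟩ : ∃ (w0 : X →₀ k) (m : k), w0 x = 0 ∧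
      w = m • Finsupp.single x 1 + w0 :=
    ⟨w - w x • Finsupp.single x 1, w x, by simp, by abel⟩
  refine ⟨(lam + m) • u' + w0, ?_, ?_⟩
  · by_cases h : lam + m = 0
    · left
      rw [← add_assoc, ← add_smul, h, zero_smul, zero_smul]
    · right
      refine ⟨lam + m, x, u', w0, hr, h, by simpa using hw0, ?_, rfl⟩
      rw [← add_assoc, ← add_smul]
  · by_cases h : m = 0
    · left
      simp [h]
    · right
      refine ⟨m, x, u', lam • u' + w0, hr, h, by simp [hx, hw0], ?_, ?_⟩
      · abel
      · rw [add_smul]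
        abel
end

section
/- Let k be a field of characteristic 0, X a set equipped with a well-founded strict order <, and r an algebraic relation on kX that is terminating with respect to <. Then the relation →_wf on kX is terminating: there is no infinite sequence u₀ →_wf u₁ →_wf u₂ →_wf ⋯ (equivalently, the converse of →_wf is well-founded). -/
/-- If `r` is terminating with respect to a well-founded strict order on `X`, then
the relation `→_wf` is terminating (its converse is well-founded). -/
theorem wfStep_terminating {k : Type*} {X : Type*} [Field k] [CharZero k]
    (r : X → (X →₀ k) → Prop) (halg : ∀ x u, r x u → x ∉ u.support)
    (lt : X → X → Prop) (htrans : Transitive lt) (hirr : Irreflexive lt)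
    (hwf : WellFounded lt)
    (hterm : ∀ x u, r x u → ∀ y ∈ u.support, lt y x) :
    WellFounded (fun u v : X →₀ k => WfStep r v u) := by
  have hs : WellFounded (fun a b : k => a = 0 ∧ b ≠ 0) := by
    have h0 : Acc (fun a b : k => a = 0 ∧ b ≠ 0) 0 := ⟨_, fun y hy => absurd rfl hy.2⟩
    exact ⟨fun a => ⟨_, fun y hy => hy.1 ▸ h0⟩⟩
  have hlex : WellFounded (Finsupp.Lex (ltᶜ ⊓ (· ≠ ·)) (fun a b : k => a = 0 ∧ b ≠ 0)) := by
    refine Finsupp.Lex.wellFounded (fun a h => h.2 rfl) hs ?_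
    refine Subrelation.wf ?_ hwf
    rintro a b ⟨h1, h2⟩
    by_contra h
    exact h1 ⟨h, h2⟩
  refine Subrelation.wf ?_ hlex
  rintro v u ⟨lam, x, u', w, hr, hlam, hx, rfl, rfl⟩
  have hx' : w x = 0 := by simpa using hx
  have hu' : u' x = 0 := by simpa using halg x u' hr
  refine ⟨x, ?_, ?_⟩
  · rintro j ⟨h1, h2⟩
    have hj : u' j = 0 := by
      by_contra h
      exact h1 (hterm x u' hr j (by simpa using h))
    have h2' : x ≠ j := fun h => h2 h.symm
    simp [hj, Finsupp.single_apply, h2']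
  · simp [hx', hu', hlam]
end

section
/- Let k be a field of characteristic 0, X a set, and r an algebraic relation on kX. A vector v ∈ kX is a normal form for →_wf (i.e., there is no w with v →_wf w) if and only if every x in the support of v is irreducible (i.e., there is no u ∈ kX with r x u). Consequently, the set of normal forms for →_wf is the sub-vector space of kX spanned by the irreducible elements of X. -/
/-- A vector is a normal form for `→_wf` iff every element of its support is
irreducible; consequently the set of normal forms is the span of the irreducible
basis vectors. -/
theorem wfStep_normalForm_iff {k : Type*} {X : Type*} [Field k] [CharZero k]
    (r : X → (X →₀ k) → Prop) (halg : ∀ x u, r x u → x ∉ u.support) :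
    (∀ v : X →₀ k, (∀ w, ¬ WfStep r v w) ↔ ∀ x ∈ v.support, ∀ u, ¬ r x u) ∧
    {v : X →₀ k | ∀ w, ¬ WfStep r v w} =
      ↑(Submodule.span k
        {f : X →₀ k | ∃ x : X, (∀ u, ¬ r x u) ∧ f = Finsupp.single x 1}) := by
  classical
  have key : ∀ v : X →₀ k, (∀ w, ¬ WfStep r v w) ↔ ∀ x ∈ v.support, ∀ u, ¬ r x u := by
    intro v
    constructor
    · intro h x hx u hr
      refine h (v x • u + v.erase x) ⟨v x, x, u, v.erase x, hr, ?_, ?_, ?_, rfl⟩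
      · exact Finsupp.mem_support_iff.mp hx
      · simp
      · rw [Finsupp.smul_single, smul_eq_mul, mul_one, Finsupp.single_add_erase]
    · rintro h w ⟨lam, x, u', w', hr, hlam, hx, hv, -⟩
      refine h x ?_ u' hr
      have hw : w' x = 0 := Finsupp.notMem_support_iff.mp hx
      rw [Finsupp.mem_support_iff, hv]
      simpa [hw] using hlam
  refine ⟨key, ?_⟩
  have himg : {f : X →₀ k | ∃ x : X, (∀ u, ¬ r x u) ∧ f = Finsupp.single x 1} =
      (fun x => Finsupp.single x (1 : k)) '' {x : X | ∀ u, ¬ r x u} := by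
    ext f
    constructor
    · rintro ⟨x, hx, rfl⟩
      exact ⟨x, hx, rfl⟩
    · rintro ⟨x, hx, rfl⟩
      exact ⟨x, hx, rfl⟩
  rw [himg, ← Finsupp.supported_eq_span_single]
  ext v
  rw [Set.mem_setOf_eq, key v, SetLike.mem_coe, Finsupp.mem_supported]
  rfl
end

section
/- (AC1 ⟹ AC2) Let k be a field of characteristic 0, X a set equipped with a well-founded strict order <, and r an algebraic relation on kX terminating with respect to <. Suppose that for every x ∈ X and u,v ∈ kX with r x u and r x v there exists w ∈ kX such that u (→_wf)* w and v (→_wf)* w. Then →_wf is confluent: for all u,v,w with u (→_wf)* v and u (→_wf)* w there exists z with v (→_wf)* z and w (→_wf)* z. -/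
open Classical in
/-- Candidate normal forms of basis elements, by well-founded recursion. -/
noncomputable def nfBasis {k : Type*} {X : Type*} [Field k] (r : X → (X →₀ k) → Prop)
    (lt : X → X → Prop) (hwf : WellFounded lt) : X → (X →₀ k) :=
  hwf.fix fun x ih =>
    if h : ∃ u, r x u then
      (Classical.choose h).sum fun y c => if hy : lt y x then c • ih y hy else 0
    else Finsupp.single x 1

theorem nfBasis_irred {k : Type*} {X : Type*} [Field k] (r : X → (X →₀ k) → Prop)
    (lt : X → X → Prop) (hwf : WellFounded lt) (x : X) (h : ¬ ∃ u, r x u) :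
    nfBasis r lt hwf x = Finsupp.single x 1 := by
  rw [nfBasis, hwf.fix_eq, dif_neg h]

theorem nfBasis_red {k : Type*} {X : Type*} [Field k] (r : X → (X →₀ k) → Prop)
    (lt : X → X → Prop) (hwf : WellFounded lt)
    (hterm : ∀ x u, r x u → ∀ y ∈ u.support, lt y x) (x : X) (h : ∃ u, r x u) :
    ∃ u, r x u ∧ nfBasis r lt hwf x = Finsupp.linearCombination k (nfBasis r lt hwf) u := by
  refine ⟨Classical.choose h, Classical.choose_spec h, ?_⟩
  conv_lhs => rw [nfBasis, hwf.fix_eq, dif_pos h]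
  rw [Finsupp.linearCombination_apply]
  refine Finsupp.sum_congr fun y hy => ?_
  rw [dif_pos (hterm x _ (Classical.choose_spec h) y hy)]
  rfl

theorem wfStep_exists_nf {k : Type*} {X : Type*} [Field k] (r : X → (X →₀ k) → Prop)
    (lt : X → X → Prop) (hwf : WellFounded lt)
    (hterm : ∀ x u, r x u → ∀ y ∈ u.support, lt y x) (M : Multiset X) :
    ∀ u : X →₀ k, u.support.val ≤ M →
      ∃ v, Relation.ReflTransGen (WfStep r) u v ∧ ∀ x ∈ v.support, ¬ ∃ t, r x t := by
  classical
  induction M using hwf.cutExpand.induction with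
  | _ M ih =>
  intro u hu
  by_cases hirr : ∀ x ∈ u.support, ¬ ∃ t, r x t
  · exact ⟨u, .refl, hirr⟩
  push Not at hirr
  obtain ⟨x, hx, t, ht⟩ := hirr
  have hxM : x ∈ M := Multiset.mem_of_le hu hx
  have hstep : WfStep r u (u x • t + u.erase x) := by
    refine ⟨u x, x, t, u.erase x, ht, Finsupp.mem_support_iff.1 hx, by simp, ?_, rfl⟩
    rw [Finsupp.smul_single, smul_eq_mul, mul_one, Finsupp.single_add_erase]
  have hcut : Relation.CutExpand lt (M.erase x + t.support.val) M := by
    refine ⟨t.support.val, x, fun y hy => hterm x t ht y hy, ?_⟩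
    rw [add_right_comm, add_comm (M.erase x), Multiset.singleton_add, Multiset.cons_erase hxM]
  obtain ⟨v, hv, hvi⟩ := ih _ hcut (u x • t + u.erase x) (by
    rw [Multiset.le_iff_subset (Finset.nodup _)]
    intro y hy
    have hy' := Finsupp.support_add hy
    rw [Finset.mem_union] at hy'
    rw [Multiset.mem_add]
    rcases hy' with h | h
    · exact Or.inr (Finsupp.support_smul h)
    · left
      rw [Finsupp.support_erase, Finset.mem_erase] at h
      exact (Multiset.mem_erase_of_ne h.1).2 (Multiset.mem_of_le hu h.2))
  exact ⟨v, .head hstep hv, hvi⟩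

/-- Steps from vectors supported below `x` preserve normal forms and stay below `x`. -/
theorem wfSteps_below {k : Type*} {X : Type*} [Field k] (r : X → (X →₀ k) → Prop)
    (lt : X → X → Prop) (htrans : Transitive lt)
    (hterm : ∀ x u, r x u → ∀ y ∈ u.support, lt y x)
    (N : X → (X →₀ k)) (x : X)
    (ih : ∀ y, lt y x → ∀ u, r y u → N y = Finsupp.linearCombination k N u)
    (u v : X →₀ k) (h : Relation.ReflTransGen (WfStep r) u v)
    (hu : ∀ y ∈ u.support, lt y x) :
    (∀ y ∈ v.support, lt y x) ∧
      Finsupp.linearCombination k N u = Finsupp.linearCombination k N v := by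
  classical
  induction h with
  | refl => exact ⟨hu, rfl⟩
  | tail _ hs hi =>
    obtain ⟨hb, he⟩ := hi
    obtain ⟨c, y, t, w, ht, hc, hw, rfl, rfl⟩ := hs
    have hwy : w y = 0 := by simpa using hw
    have hyx : lt y x := hb y (by simp [hwy, hc])
    refine ⟨fun z hz => ?_, ?_⟩
    · rcases Finset.mem_union.1 (Finsupp.support_add hz) with h | h
      · exact htrans (hterm y t ht z (Finsupp.support_smul h)) hyx
      · apply hb z
        have hzy : y ≠ z := by
          rintro rfl
          exact hw h
        simpa [Finsupp.single_apply, hzy] using h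
    · rw [he]
      simp only [map_add, map_smul, Finsupp.linearCombination_single, one_smul]
      rw [ih y hyx t ht]

/-- (AC1 ⟹ AC2) If all critical pairs of an algebraic relation terminating w.r.t.
a well-founded strict order are joinable, then `→_wf` is confluent. -/
theorem wfStep_confluent_of_local {k : Type*} {X : Type*} [Field k] [CharZero k]
    (r : X → (X →₀ k) → Prop) (halg : ∀ x u, r x u → x ∉ u.support)
    (lt : X → X → Prop) (htrans : Transitive lt) (hirr : Irreflexive lt)
    (hwf : WellFounded lt)
    (hterm : ∀ x u, r x u → ∀ y ∈ u.support, lt y x)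
    (hlc : ∀ (x : X) (u v : X →₀ k), r x u → r x v →
      ∃ w, Relation.ReflTransGen (WfStep r) u w ∧ Relation.ReflTransGen (WfStep r) v w) :
    ∀ u v w : X →₀ k, Relation.ReflTransGen (WfStep r) u v →
      Relation.ReflTransGen (WfStep r) u w →
      ∃ z, Relation.ReflTransGen (WfStep r) v z ∧ Relation.ReflTransGen (WfStep r) w z := by
  set N := nfBasis r lt hwf with hN
  have key : ∀ x u, r x u → N x = Finsupp.linearCombination k N u := by
    intro x
    induction x using hwf.induction with
    | _ x ih =>
    intro u hu
    obtain ⟨t, ht, hNt⟩ := nfBasis_red r lt hwf hterm x ⟨u, hu⟩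
    obtain ⟨w, h1, h2⟩ := hlc x u t hu ht
    have e1 := (wfSteps_below r lt htrans hterm N x ih u w h1 (hterm x u hu)).2
    have e2 := (wfSteps_below r lt htrans hterm N x ih t w h2 (hterm x t ht)).2
    rw [e1, ← e2]
    exact hNt
  have inv : ∀ u v, Relation.ReflTransGen (WfStep r) u v →
      Finsupp.linearCombination k N u = Finsupp.linearCombination k N v := by
    intro u v h
    induction h with
    | refl => rfl
    | tail _ hs he =>
      obtain ⟨c, y, t, w, ht, hc, hw, rfl, rfl⟩ := hs
      rw [he]
      simp only [map_add, map_smul, Finsupp.linearCombination_single, one_smul]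
      rw [key y t ht]
  have red : ∀ u, Relation.ReflTransGen (WfStep r) u (Finsupp.linearCombination k N u) := by
    intro u
    obtain ⟨v, hv, hvi⟩ := wfStep_exists_nf r lt hwf hterm u.support.val u le_rfl
    have : Finsupp.linearCombination k N v = v := by
      rw [Finsupp.linearCombination_apply]
      conv_rhs => rw [← Finsupp.sum_single v]
      refine Finsupp.sum_congr fun y hy => ?_
      rw [hN, nfBasis_irred r lt hwf y (hvi y hy)]
      simp
    rw [inv u v hv, this]
    exact hv
  intro u v w hv hw
  refine ⟨_, red v, ?_⟩
  rw [← inv u v hv, inv u w hw]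
  exact red w
end

section
/- (AC2 ⟹ AC3) Let k be a field of characteristic 0, X a set equipped with a well-founded strict order <, and r an algebraic relation on kX terminating with respect to <. If →_wf is confluent, then the canonical map from NF(→), the subspace of normal forms for →_wf, to the quotient kX/↔* (sending a normal form to its equivalence class modulo ↔*, the equivalence relation generated by →_alg) is a bijection. -/
theorem algStep_affine {k : Type*} {X : Type*} [Field k] {r : X → (X →₀ k) → Prop}
    (c : k) (a : X →₀ k) {u v : X →₀ k} (h : AlgStep r u v) :
    AlgStep r (c • u + a) (c • v + a) := by
  obtain ⟨lam, x, u', w, hr, rfl, rfl⟩ := h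
  refine ⟨c * lam, x, u', c • w + a, hr, ?_, ?_⟩ <;> rw [smul_add, smul_smul, add_assoc]

theorem eqvGen_affine {k : Type*} {X : Type*} [Field k] {r : X → (X →₀ k) → Prop}
    (c : k) (a : X →₀ k) {u v : X →₀ k} (h : Relation.EqvGen (AlgStep r) u v) :
    Relation.EqvGen (AlgStep r) (c • u + a) (c • v + a) := by
  induction h with
  | rel _ _ h => exact .rel _ _ (algStep_affine c a h)
  | refl _ => exact .refl _
  | symm _ _ _ ih => exact .symm _ _ ih
  | trans _ _ _ _ _ ih1 ih2 => exact .trans _ _ _ ih1 ih2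

theorem eqvGen_add {k : Type*} {X : Type*} [Field k] {r : X → (X →₀ k) → Prop}
    {u v u' v' : X →₀ k} (h : Relation.EqvGen (AlgStep r) u v)
    (h' : Relation.EqvGen (AlgStep r) u' v') :
    Relation.EqvGen (AlgStep r) (u + u') (v + v') := by
  have h1 := eqvGen_affine 1 u' h
  have h2 := eqvGen_affine 1 v h'
  rw [one_smul, one_smul] at h1 h2
  rw [add_comm u' v, add_comm v' v] at h2
  exact .trans _ _ _ h1 h2

/-- Reducing all of the `x`-coefficient of a vector takes at most one step. -/
theorem reduce_coeff {k : Type*} {X : Type*} [Field k] {r : X → (X →₀ k) → Prop}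
    {x : X} {u' w : X →₀ k} (c : k) (hr : r x u') (hx : x ∉ w.support) :
    Relation.ReflTransGen (WfStep r) (c • Finsupp.single x 1 + w) (c • u' + w) := by
  by_cases hc : c = 0
  · subst hc
    simp only [zero_smul]
    exact .refl
  · exact .single ⟨c, x, u', w, hr, hc, hx, rfl, rfl⟩

theorem algStep_joinable {k : Type*} {X : Type*} [Field k] {r : X → (X →₀ k) → Prop}
    (halg : ∀ x u, r x u → x ∉ u.support) {u v : X →₀ k} (h : AlgStep r u v) :
    ∃ z, Relation.ReflTransGen (WfStep r) u z ∧ Relation.ReflTransGen (WfStep r) v z := by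
  obtain ⟨lam, x, u', w, hr, rfl, rfl⟩ := h
  have hu' := halg x u' hr
  have hu0 : u' x = 0 := Finsupp.notMem_support_iff.mp hu'
  obtain ⟨c, w0, hw0, rfl⟩ : ∃ (c : k) (w0 : X →₀ k), w0 x = 0 ∧
      w = c • Finsupp.single x 1 + w0 :=
    ⟨w x, w - w x • Finsupp.single x 1, by simp, by abel⟩
  refine ⟨(lam + c) • u' + w0, ?_, ?_⟩
  · have := reduce_coeff (w := w0) (lam + c) hr (by simpa using hw0)
    rwa [add_smul lam c (Finsupp.single x (1 : k)), add_assoc] at this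
  · have := reduce_coeff (w := lam • u' + w0) c hr (by simp [hw0, hu0])
    have e : (lam + c) • u' + w0 = c • u' + (lam • u' + w0) := by rw [add_smul]; abel
    rw [e]
    convert this using 1
    abel

theorem wfStep_iff_exists {k : Type*} {X : Type*} [Field k] {r : X → (X →₀ k) → Prop}
    (u : X →₀ k) : (∀ w, ¬ WfStep r u w) ↔ ∀ x u', r x u' → u x = 0 := by
  constructor
  · intro h x u' hr
    by_contra hx
    exact h _ ⟨u x, x, u', u - u x • Finsupp.single x 1, hr, hx, by simp, by abel, rfl⟩
  · rintro h w ⟨lam, x, u', w', hr, hl, hx, rfl, rfl⟩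
    have := h x u' hr
    rw [Finsupp.notMem_support_iff] at hx
    simp [hx] at this
    exact hl this

/-- (AC2 ⟹ AC3) If `→_wf` is confluent, then the canonical map from the space of
normal forms to the quotient of `kX` by the equivalence relation generated by `→_alg`
is a bijection. -/
theorem nf_to_quotient_bijective_of_wfStep_confluent {k : Type*} {X : Type*}
    [Field k] [CharZero k]
    (r : X → (X →₀ k) → Prop) (halg : ∀ x u, r x u → x ∉ u.support)
    (lt : X → X → Prop) (htrans : Transitive lt) (hirr : Irreflexive lt)
    (hwf : WellFounded lt)
    (hterm : ∀ x u, r x u → ∀ y ∈ u.support, lt y x)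
    (hconf : ∀ u v w : X →₀ k, Relation.ReflTransGen (WfStep r) u v →
      Relation.ReflTransGen (WfStep r) u w →
      ∃ z, Relation.ReflTransGen (WfStep r) v z ∧ Relation.ReflTransGen (WfStep r) w z) :
    Function.Bijective
      (fun v : {v : X →₀ k // ∀ w, ¬ WfStep r v w} =>
        Quot.mk (Relation.EqvGen (AlgStep r)) v.val) := by
  have hjoin : ∀ u v : X →₀ k, Relation.EqvGen (AlgStep r) u v →
      ∃ z, Relation.ReflTransGen (WfStep r) u z ∧ Relation.ReflTransGen (WfStep r) v z := by
    intro u v h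
    induction h with
    | rel _ _ h => exact algStep_joinable halg h
    | refl u => exact ⟨u, .refl, .refl⟩
    | symm _ _ _ ih => exact ih.imp fun _ h => h.symm
    | trans _ _ _ _ _ ih1 ih2 =>
      obtain ⟨z1, h1, h1'⟩ := ih1
      obtain ⟨z2, h2, h2'⟩ := ih2
      obtain ⟨z, hz1, hz2⟩ := hconf _ _ _ h1' h2
      exact ⟨z, h1.trans hz1, h2'.trans hz2⟩
  have hnf : ∀ u z : X →₀ k, (∀ w, ¬ WfStep r u w) →
      Relation.ReflTransGen (WfStep r) u z → u = z := by
    intro u z hu h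
    rcases h.cases_head with h | ⟨c, h, _⟩
    · exact h
    · exact absurd h (hu c)
  constructor
  · rintro ⟨u, hu⟩ ⟨v, hv⟩ h
    have h1 : Relation.EqvGen (AlgStep r) u v :=
      (Relation.EqvGen.is_equivalence (AlgStep r)).eqvGen_iff.mp (Quot.eqvGen_exact h)
    obtain ⟨z, h1, h2⟩ := hjoin u v h1
    exact Subtype.ext ((hnf u z hu h1).trans (hnf v z hv h2).symm)
  · suffices H : ∀ u : X →₀ k, ∃ v : X →₀ k, (∀ x u', r x u' → v x = 0) ∧
        Relation.EqvGen (AlgStep r) v u by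
      intro q
      induction q using Quot.ind with
      | mk u =>
        obtain ⟨v, hv, h⟩ := H u
        exact ⟨⟨v, (wfStep_iff_exists v).mpr hv⟩, Quot.sound h⟩
    -- the vectors supported on normalizable basis elements are normalizable
    have key : ∀ u : X →₀ k, (∀ y ∈ u.support, ∃ v : X →₀ k,
        (∀ x u', r x u' → v x = 0) ∧
        Relation.EqvGen (AlgStep r) v (Finsupp.single y 1)) →
        ∃ v : X →₀ k, (∀ x u', r x u' → v x = 0) ∧ Relation.EqvGen (AlgStep r) v u := by
      intro u
      induction u using Finsupp.induction with
      | zero => exact fun _ => ⟨0, fun _ _ _ => rfl, .refl _⟩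
      | single_add a b f ha hb ih =>
        intro h
        have hs := Finsupp.support_single_add (b := b) ha hb
        obtain ⟨v1, hv1, h1⟩ := h a (by rw [hs]; simp)
        obtain ⟨v2, hv2, h2⟩ := ih fun y hy => h y (by rw [hs]; simp [hy])
        refine ⟨b • v1 + v2, fun x u' hr => by simp [hv1 x u' hr, hv2 x u' hr], ?_⟩
        have := eqvGen_affine b 0 h1
        simp only [add_zero, Finsupp.smul_single, smul_eq_mul, mul_one] at this
        exact eqvGen_add this h2
    have base : ∀ y : X, ∃ v : X →₀ k, (∀ x u', r x u' → v x = 0) ∧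
        Relation.EqvGen (AlgStep r) v (Finsupp.single y 1) := by
      intro y
      induction y using hwf.induction with
      | _ y ih =>
        by_cases hy : ∃ u', r y u'
        · obtain ⟨u', hr⟩ := hy
          obtain ⟨v, hv, h⟩ := key u' fun z hz => ih z (hterm y u' hr z hz)
          exact ⟨v, hv, .trans _ _ _ h (.symm _ _ (.rel _ _
            ⟨1, y, u', 0, hr, by simp, by simp⟩))⟩
        · refine ⟨Finsupp.single y 1, fun x u' hr => ?_, .refl _⟩
          have hne : y ≠ x := fun e => hy ⟨u', e ▸ hr⟩
          simp [Finsupp.single_apply, hne]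
    exact fun u => key u fun y _ => base y
end

section
/- (AC3 ⟹ AC1) Let k be a field of characteristic 0, X a set equipped with a well-founded strict order <, and r an algebraic relation on kX terminating with respect to <. If the canonical map from NF(→), the subspace of normal forms for →_wf, to the quotient kX/↔* is a bijection, then for every x ∈ X and u,v ∈ kX with r x u and r x v, there exists w ∈ kX such that u (→_wf)* w and v (→_wf)* w. -/
theorem wfStep_dm {k : Type*} {X : Type*} [Field k] [Preorder X]
    (r : X → (X →₀ k) → Prop) (halg : ∀ x u, r x u → x ∉ u.support)
    (hterm : ∀ x u, r x u → ∀ y ∈ u.support, y < x) (u v : X →₀ k) (h : WfStep r u v) :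
    Multiset.IsDershowitzMannaLT v.support.val u.support.val := by
  classical
  obtain ⟨lam, x, u', w, hr, hl, hx, rfl, rfl⟩ := h
  have hx' := halg x u' hr
  simp only [Finsupp.mem_support_iff, not_not] at hx hx'
  have key : ∀ s t : Finset X, s.val = (s ∩ t).val + (s \ t).val := by
    intro s t
    have hd : Disjoint (s ∩ t) (s \ t) := (Finset.disjoint_sdiff_inter s t).symm
    rw [← Finset.disjUnion_val _ _ hd, Finset.disjUnion_eq_union, Finset.union_comm,
      Finset.sdiff_union_inter]
  set a := lam • Finsupp.single x (1 : k) + w with ha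
  set b := lam • u' + w with hb
  have hxm : x ∈ a.support \ b.support := by
    simp [ha, hb, hx, hx', hl]
  refine ⟨(b.support ∩ a.support).val, (b.support \ a.support).val,
    (a.support \ b.support).val, ?_, key _ _, ?_, ?_⟩
  · intro h0
    have : x ∈ (a.support \ b.support).val := hxm
    rw [h0] at this
    simp at this
  · rw [Finset.inter_comm]
    exact key _ _
  · intro y hy
    refine ⟨x, hxm, hterm x u' hr y ?_⟩
    have hy' : y ∈ b.support \ a.support := hy
    rw [Finset.mem_sdiff, Finsupp.mem_support_iff, Finsupp.mem_support_iff, not_not] at hy'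
    obtain ⟨h1, h2⟩ := hy'
    have hyx : y ≠ x := by
      rintro rfl
      apply h1
      simp [hb, hx, hx']
    have hw : w y = 0 := by
      simpa [ha, Finsupp.single_apply, hyx.symm] using h2
    rw [Finsupp.mem_support_iff]
    intro h3
    apply h1
    simp [hb, hw, h3]

theorem exists_nf {k : Type*} {X : Type*} [Field k]
    (r : X → (X →₀ k) → Prop) (halg : ∀ x u, r x u → x ∉ u.support)
    (lt : X → X → Prop) (htrans : Transitive lt) (hirr : Irreflexive lt)
    (hwf : WellFounded lt)
    (hterm : ∀ x u, r x u → ∀ y ∈ u.support, lt y x) (u : X →₀ k) :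
    ∃ n, Relation.ReflTransGen (WfStep r) u n ∧ ∀ w, ¬ WfStep r n w := by
  letI : PartialOrder X :=
    @partialOrderOfSO X lt { irrefl := hirr, trans := fun _ _ _ h1 h2 => htrans h1 h2 }
  haveI : WellFoundedLT X := ⟨hwf⟩
  have wf : WellFounded (fun v u : X →₀ k => WfStep r u v) :=
    Subrelation.wf (fun {v u} h => wfStep_dm r halg hterm u v h)
      (InvImage.wf (fun u : X →₀ k => u.support.val) Multiset.wellFounded_isDershowitzMannaLT)
  induction u using wf.induction with
  | _ u ih =>
    by_cases h : ∃ w, WfStep r u w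
    · obtain ⟨w, hw⟩ := h
      obtain ⟨n, hn, hn'⟩ := ih w hw
      exact ⟨n, .head hw hn, hn'⟩
    · exact ⟨u, .refl, fun w hw => h ⟨w, hw⟩⟩

theorem eqvGen_of_wf {k : Type*} {X : Type*} [Field k]
    (r : X → (X →₀ k) → Prop) {u v : X →₀ k} (h : Relation.ReflTransGen (WfStep r) u v) :
    Relation.EqvGen (AlgStep r) u v := by
  induction h with
  | refl => exact .refl _
  | tail _ h ih =>
    obtain ⟨lam, x, u', w, hr, -, -, h1, h2⟩ := h
    exact .trans _ _ _ ih (.rel _ _ ⟨lam, x, u', w, hr, h1, h2⟩)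

/-- (AC3 ⟹ AC1) If the canonical map from the space of normal forms to the quotient
of `kX` by the equivalence relation generated by `→_alg` is a bijection, then all
critical pairs are joinable. -/
theorem local_confluence_of_nf_to_quotient_bijective {k : Type*} {X : Type*}
    [Field k] [CharZero k]
    (r : X → (X →₀ k) → Prop) (halg : ∀ x u, r x u → x ∉ u.support)
    (lt : X → X → Prop) (htrans : Transitive lt) (hirr : Irreflexive lt)
    (hwf : WellFounded lt)
    (hterm : ∀ x u, r x u → ∀ y ∈ u.support, lt y x)
    (hbij : Function.Bijective
      (fun v : {v : X →₀ k // ∀ w, ¬ WfStep r v w} =>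
        Quot.mk (Relation.EqvGen (AlgStep r)) v.val)) :
    ∀ (x : X) (u v : X →₀ k), r x u → r x v →
      ∃ w, Relation.ReflTransGen (WfStep r) u w ∧ Relation.ReflTransGen (WfStep r) v w := by
  intro x u v hu hv
  obtain ⟨n, hn, hn'⟩ := exists_nf r halg lt htrans hirr hwf hterm u
  obtain ⟨m, hm, hm'⟩ := exists_nf r halg lt htrans hirr hwf hterm v
  have st : ∀ u, r x u → Relation.EqvGen (AlgStep r) (Finsupp.single x 1) u := fun u h =>
    .rel _ _ ⟨1, x, u, 0, h, by simp, by simp⟩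
  have hnm : Relation.EqvGen (AlgStep r) n m :=
    .trans _ _ _ (.symm _ _ (.trans _ _ _ (st u hu) (eqvGen_of_wf r hn)))
      (.trans _ _ _ (st v hv) (eqvGen_of_wf r hm))
  have := @hbij.1 ⟨n, hn'⟩ ⟨m, hm'⟩ (Quot.sound hnm)
  have hEq : n = m := congrArg Subtype.val this
  subst hEq
  exact ⟨n, hn, hm⟩
end

section
/- Let k be a field of characteristic 0, X a set equipped with a well-founded strict order <, and r an algebraic relation on kX terminating with respect to <. For all u,v ∈ kX, u ↔* v (the equivalence relation generated by →_alg) holds if and only if u − v belongs to the linear span of the set {x − u' | r x u'} (where x denotes the basis vector single x 1). -/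
/-- The equivalence relation generated by `→_alg` identifies `u` and `v` iff `u - v`
lies in the span of the vectors `x - u'` for `r x u'`. -/
theorem eqvGen_algStep_iff_sub_mem_span {k : Type*} {X : Type*} [Field k] [CharZero k]
    (r : X → (X →₀ k) → Prop) (halg : ∀ x u, r x u → x ∉ u.support)
    (lt : X → X → Prop) (htrans : Transitive lt) (hirr : Irreflexive lt)
    (hwf : WellFounded lt)
    (hterm : ∀ x u, r x u → ∀ y ∈ u.support, lt y x) :
    ∀ u v : X →₀ k, Relation.EqvGen (AlgStep r) u v ↔
      u - v ∈ Submodule.span k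
        {f : X →₀ k | ∃ (x : X) (u' : X →₀ k), r x u' ∧ f = Finsupp.single x 1 - u'} := by
  intro u v
  constructor
  · intro h
    induction h with
    | rel a b h =>
      obtain ⟨lam, x, u', w, hr, rfl, rfl⟩ := h
      have e : lam • Finsupp.single x 1 + w - (lam • u' + w)
          = lam • (Finsupp.single x 1 - u') := by
        rw [smul_sub]; abel
      rw [e]
      exact Submodule.smul_mem _ _ (Submodule.subset_span ⟨x, u', hr, rfl⟩)
    | refl a => rw [sub_self]; exact Submodule.zero_mem _
    | symm a b _ ih => rw [← neg_sub]; exact Submodule.neg_mem _ ih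
    | trans a b c _ _ ih1 ih2 =>
      rw [← sub_add_sub_cancel a b c]; exact Submodule.add_mem _ ih1 ih2
  · intro h
    have key : ∀ f ∈ Submodule.span k
        {f : X →₀ k | ∃ (x : X) (u' : X →₀ k), r x u' ∧ f = Finsupp.single x 1 - u'},
        ∀ (a : k) (w : X →₀ k), Relation.EqvGen (AlgStep r) (w + a • f) w := by
      intro f hf
      induction hf using Submodule.span_induction with
      | mem f hf =>
        obtain ⟨x, u', hr, rfl⟩ := hf
        intro a w
        refine Relation.EqvGen.rel _ _ ⟨a, x, u', w - a • u', hr, ?_, ?_⟩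
        · rw [smul_sub]; abel
        · abel
      | zero =>
        intro a w
        rw [smul_zero, add_zero]; exact Relation.EqvGen.refl _
      | add f g _ _ ihf ihg =>
        intro a w
        rw [smul_add, ← add_assoc]
        exact Relation.EqvGen.trans _ _ _ (ihg a _) (ihf a w)
      | smul c f _ ih =>
        intro a w
        rw [smul_smul]; exact ih _ w
    have := key _ h 1 v
    rwa [one_smul, add_sub_cancel] at this
end
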